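/- arXiv:1409.0352 — 2 statements merged into one kernel-verified Lean document; each statement's English description precedes it below -/
import Mathlib

section
/- The missing digit set MDS(𝒜) has Hausdorff dimension γ_𝒜 = log(#𝒜) / log(q), and its Hausdorff γ_𝒜-measure equals 1: ℋ^{γ_𝒜}(MDS(𝒜)) = 1. -/
/-!
Setting: `𝔽_q((X⁻¹))`, the field of formal Laurent series over the finite field `𝔽_q`
with `q = pⁿ` elements (`F` below is an arbitrary finite field; its cardinality `q` is
automatically a prime power), with absolute value `|f| = q^N` when
`f = ∑_{n ≥ -N} a_{-n} X^{-n}` with `a_N ≠ 0`, and `|0| = 0`.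
We model it as `LaurentSeries F` in the variable `t = X⁻¹`, so the coefficient `a_{-n}` of
`X^{-n}` is the coefficient of `t^n`, and `|f| = q^{-ord_t f}`.
-/

noncomputable section
open scoped ENNReal Classical

variable (F : Type) [Field F] [Fintype F]

/-- The field `𝔽_q((X⁻¹))`, modelled as Laurent series in `t = X⁻¹`. -/
abbrev LF (F : Type) [Field F] := LaurentSeries F

/-- `q`, the cardinality of the coefficient field. -/
def qc : ℕ := Fintype.card F

/-- The element `X`, i.e. `t⁻¹`. -/
def XL : LF F := HahnSeries.single (-1 : ℤ) 1

/-- The absolute value: `|f| = q^{-ord_t f}` for `f ≠ 0` and `|0| = 0`. -/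
def absv (f : LF F) : ℝ := if f = 0 then 0 else (qc F : ℝ) ^ (-f.order)

/-- The ball of radius `r` around `x` for the ultrametric `d(x, y) = |x - y|`. -/
def ball (x : LF F) (r : ℝ) : Set (LF F) := {y | absv F (y - x) < r}

/-- The unit ball `𝕀 = {h : |h| < 1}` around `0`. -/
def unitBall : Set (LF F) := ball F 0 1

/-- The missing digit set `MDS(𝒜)`: elements of `𝕀` all of whose coefficients `a_{-n}`
lie in `𝒜`. -/
def MDS (A : Set F) : Set (LF F) :=
  {f | (∀ m : ℤ, m ≤ 0 → f.coeff m = 0) ∧ ∀ m : ℤ, 1 ≤ m → f.coeff m ∈ A}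

/-- `γ_𝒜 = log #𝒜 / log q`. -/
def gammaA (A : Set F) : ℝ := Real.log A.ncard / Real.log (qc F)

/-- The Hausdorff `f`-measure of `A ⊆ 𝔽_q((X⁻¹))`, as defined in the paper:
`ℋ^f(A) = lim_{ρ → 0} inf ∑ᵢ f(r(Bᵢ))`, the infimum being over countable covers of `A`
by balls `Bᵢ` with radius `r(Bᵢ) ≤ ρ`.  Every ball has radius `q^k` for some `k ∈ ℤ`;
a ball is recorded as a pair (centre, k).  (The `⨆` over `ρ` is the limit `ρ → 0`, the inner
infimum being antitone in `ρ`.) -/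
def hmeas (f : ℝ → ℝ) (A : Set (LF F)) : ℝ≥0∞ :=
  ⨆ (ρ : ℝ) (_ : 0 < ρ),
    ⨅ (S : Set (LF F × ℤ)) (_ : S.Countable)
      (_ : ∀ p ∈ S, (qc F : ℝ) ^ p.2 ≤ ρ)
      (_ : A ⊆ ⋃ p ∈ S, ball F p.1 ((qc F : ℝ) ^ p.2)),
      ∑' p : S, ENNReal.ofReal (f ((qc F : ℝ) ^ (p : LF F × ℤ).2))

/-- A dimension function: a continuous, non-decreasing `f : ℝ_{≥0} → ℝ_{≥0}` with `f 0 = 0`. -/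
structure IsDimFun (f : ℝ → ℝ) : Prop where
  mono : MonotoneOn f (Set.Ici 0)
  cont : ContinuousOn f (Set.Ici 0)
  zero : f 0 = 0
  nonneg : ∀ r, 0 ≤ r → 0 ≤ f r

/-- The image of a polynomial `g ∈ 𝔽_q[X]` in `𝔽_q((X⁻¹))`. -/
def toL (g : Polynomial F) : LF F := Polynomial.aeval (XL F) g

/-- `ℱ_𝒜(N)`: polynomials over `𝔽_q` of degree `< N`, all of whose coefficients
`a_0, …, a_{N-1}` lie in `𝒜`. -/
def FsetA (A : Set F) (N : ℕ) : Set (Polynomial F) :=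
  {g | g.degree < (N : ℕ) ∧ ∀ k < N, g.coeff k ∈ A}

/-- `W_{MDS(𝒜)}(ψ)`: elements `h ∈ MDS(𝒜)` with `|h - g/X^N| < ψ(q^N)` for infinitely many
`N ∈ ℕ`, where `g ∈ ℱ_𝒜(N)`.  Here `ψ N` stands for `ψ(q^N)`. -/
def WMDS (A : Set F) (ψ : ℕ → ℝ) : Set (LF F) :=
  {h ∈ MDS F A | ∀ m : ℕ, ∃ N : ℕ, m ≤ N ∧ 1 ≤ N ∧
    ∃ g ∈ FsetA F A N, absv F (h - toL F g / XL F ^ N) < ψ N}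

/-- `𝒦(ψ)`: elements `ξ ∈ 𝕀` with `|ξ - g/h| < ψ(|h|)` for infinitely many fractions
`g/h ∈ 𝔽_q(X)`.  Here `ψ d` stands for `ψ(q^d)`, and `|h| = q^{deg h}`. -/
def Kset (ψ : ℕ → ℝ) : Set (LF F) :=
  {ξ ∈ unitBall F | {gh : Polynomial F × Polynomial F | gh.2 ≠ 0 ∧
    absv F (ξ - toL F gh.1 / toL F gh.2) < ψ gh.2.natDegree}.Infinite}

/-- The irrationality exponent
`τ(ξ) = sup {τ : |ξ - g/h| < |h|^{-τ} for infinitely many g/h ∈ 𝔽_q(X)}`, valued in `[0, ∞]`. -/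
def irrExp (ξ : LF F) : ℝ≥0∞ :=
  sSup {t : ℝ≥0∞ | ∃ τ : ℝ, t = ENNReal.ofReal τ ∧
    {gh : Polynomial F × Polynomial F | gh.2 ≠ 0 ∧
      absv F (ξ - toL F gh.1 / toL F gh.2) < absv F (toL F gh.2) ^ (-τ)}.Infinite}

open MeasureTheory

variable {F} in
theorem mem_ball_zpow_iff (hq : 1 < qc F) (x y : LF F) (k : ℤ) :
    y ∈ ball F x ((qc F : ℝ) ^ k) ↔ ∀ m : ℤ, m ≤ -k → y.coeff m = x.coeff m := by
  have hq' : (1 : ℝ) < qc F := by exact_mod_cast hq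
  by_cases h : y - x = 0
  · rw [sub_eq_zero] at h
    subst h
    simp only [ball, absv, Set.mem_ofPred_eq, sub_self, if_true, implies_true, iff_true]
    positivity
  · simp only [ball, absv, Set.mem_ofPred_eq, if_neg h]
    rw [zpow_lt_zpow_iff_right₀ hq', neg_lt, ← Int.add_one_le_iff, HahnSeries.le_order_iff_forall h]
    simp only [HahnSeries.coeff_sub, sub_eq_zero, Int.lt_add_one_iff]

/-- The element of `𝕀` with prescribed digits. -/
def ofDigits (w : ℕ → F) : LF F :=
  HahnSeries.ofSuppBddBelow (fun m : ℤ => if 1 ≤ m then w (m - 1).toNat else 0)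
    ⟨1, fun m hm => by
      by_contra h
      simp [h] at hm⟩

omit [Fintype F] in
theorem ofDigits_coeff (w : ℕ → F) (m : ℤ) :
    (ofDigits F w).coeff m = if 1 ≤ m then w (m - 1).toNat else 0 := rfl

variable {F} in
omit [Fintype F] in
theorem ofDigits_mem_MDS {A : Set F} {w : ℕ → F} (hw : ∀ i, w i ∈ A) : ofDigits F w ∈ MDS F A := by
  refine ⟨fun m hm => ?_, fun m hm => ?_⟩
  · rw [ofDigits_coeff, if_neg (by omega)]
  · rw [ofDigits_coeff, if_pos hm]
    exact hw _

omit [Field F] in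
theorem gammaA_pos (A : Set F) (hA : 2 ≤ A.ncard) (hq : 1 < qc F) : 0 < gammaA F A :=
  div_pos (Real.log_pos (by exact_mod_cast hA)) (Real.log_pos (by exact_mod_cast hq))

omit [Field F] in
theorem qc_rpow_gammaA (A : Set F) (hA : 2 ≤ A.ncard) (hq : 1 < qc F) :
    (qc F : ℝ) ^ gammaA F A = A.ncard := by
  have hlog : 0 < Real.log (qc F) := Real.log_pos (by exact_mod_cast hq)
  rw [Real.rpow_def_of_pos (by positivity), gammaA, mul_div_cancel₀ _ hlog.ne',
    Real.exp_log (by positivity)]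

/-- The uniform distribution on sequences of digits in `A`. -/
def digitMeasure (A : Set F) [Nonempty A] : @Measure (ℕ → A) (@MeasurableSpace.pi _ _ fun _ => ⊤) :=
  letI : MeasurableSpace A := ⊤
  Measure.infinitePi fun _ : ℕ => (PMF.uniformOfFintype A).toMeasure

omit [Field F] in
theorem digitMeasure_univ (A : Set F) [Nonempty A] : digitMeasure F A Set.univ = 1 := by
  let _ : MeasurableSpace A := ⊤
  rw [digitMeasure]
  exact measure_univ

theorem digitMeasure_preimage_ball_le (A : Set F) [Nonempty A] (hq : 1 < qc F) (x : LF F) (n : ℕ) :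
    digitMeasure F A {w | ofDigits F (fun i => w i) ∈ ball F x ((qc F : ℝ) ^ (-(n : ℤ)))} ≤
      ((A.ncard : ℝ≥0∞)⁻¹) ^ n := by
  let _ : MeasurableSpace A := ⊤
  have hsub : {w : ℕ → A | ofDigits F (fun i => w i) ∈ ball F x ((qc F : ℝ) ^ (-(n : ℤ)))} ⊆
      Set.pi (Finset.range n) (fun i => {a : A | (a : F) = x.coeff (i + 1)}) := by
    intro w hw i hi
    rw [Set.mem_ofPred_eq, mem_ball_zpow_iff hq] at hw
    have hi' : i < n := by simpa using hi
    have := hw (i + 1) (by omega)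
    rw [ofDigits_coeff, if_pos (by omega)] at this
    simpa using this
  have hdigit : ∀ c : F, (PMF.uniformOfFintype A).toMeasure {a : A | (a : F) = c} ≤
      (A.ncard : ℝ≥0∞)⁻¹ := by
    intro c
    by_cases hc : c ∈ A
    · have : {a : A | (a : F) = c} = {⟨c, hc⟩} := by
        ext a
        simp [Subtype.ext_iff]
      rw [this, PMF.toMeasure_apply_singleton _ _ MeasurableSpace.measurableSet_top, PMF.uniformOfFintype_apply,
        ← Nat.card_eq_fintype_card, Nat.card_coe_set_eq]
    · have : {a : A | (a : F) = c} = ∅ := by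
        ext a
        simp only [Set.mem_ofPred_eq, Set.mem_empty_iff_false, iff_false]
        rintro rfl
        exact hc a.2
      simp [this]
  refine (measure_mono hsub).trans ?_
  rw [digitMeasure, Measure.infinitePi_pi _ fun _ _ => MeasurableSpace.measurableSet_top]
  refine (Finset.prod_le_prod' fun i _ => hdigit _).trans ?_
  simp

theorem one_le_hmeas_MDS (A : Set F) (hA : 2 ≤ A.ncard) (hq : 1 < qc F) {s : ℝ}
    (hs : s ≤ gammaA F A) : 1 ≤ hmeas F (fun r => r ^ s) (MDS F A) := by
  have : Nonempty A := (Set.nonempty_of_ncard_ne_zero (by omega)).to_subtype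
  have hq' : (1 : ℝ) < qc F := by exact_mod_cast hq
  have ha : (0 : ℝ) < A.ncard := by exact_mod_cast (by omega : 0 < A.ncard)
  refine le_iSup₂_of_le 1 one_pos (le_iInf fun S => le_iInf fun hS => le_iInf fun hρ =>
    le_iInf fun hcov => ?_)
  have huniv : (Set.univ : Set (ℕ → A)) ⊆
      ⋃ p ∈ S, {w | ofDigits F (fun i => w i) ∈ ball F p.1 ((qc F : ℝ) ^ p.2)} := by
    intro w _
    have := hcov (ofDigits_mem_MDS (w := fun i => (w i : F)) fun i => (w i).2)
    simpa using this
  calc (1 : ℝ≥0∞) = digitMeasure F A Set.univ := (digitMeasure_univ F A).symm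
    _ ≤ _ := measure_mono huniv
    _ ≤ _ := measure_biUnion_le _ hS _
    _ ≤ _ := ENNReal.tsum_le_tsum fun p => ?_
  obtain ⟨⟨x, k⟩, hp⟩ := p
  have hk : k ≤ 0 := by
    have := hρ _ hp
    rwa [← zpow_zero (qc F : ℝ), zpow_le_zpow_iff_right₀ hq'] at this
  obtain ⟨n, rfl⟩ : ∃ n : ℕ, k = -(n : ℤ) := ⟨(-k).toNat, by omega⟩
  refine (digitMeasure_preimage_ball_le F A hq x n).trans ?_
  have hpow : ((A.ncard : ℝ)⁻¹) ^ n ≤ ((qc F : ℝ) ^ (-(n : ℤ))) ^ s := by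
    calc ((A.ncard : ℝ)⁻¹) ^ n = ((qc F : ℝ) ^ (-(n : ℤ))) ^ gammaA F A := by
          rw [← Real.rpow_intCast, ← Real.rpow_mul (by positivity), mul_comm,
            Real.rpow_mul (by positivity), qc_rpow_gammaA F A hA hq, Real.rpow_intCast, zpow_neg,
            zpow_natCast, inv_pow]
      _ ≤ _ := Real.rpow_le_rpow_of_exponent_ge (by positivity)
          (zpow_le_one_of_nonpos₀ hq'.le hk) hs
  refine le_trans (le_of_eq ?_) (ENNReal.ofReal_le_ofReal hpow)
  rw [ENNReal.ofReal_pow (by positivity), ENNReal.ofReal_inv_of_pos ha, ENNReal.ofReal_natCast]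

/-- `MDS A` is covered by at most `(#A) ^ n` balls of radius `q ^ (-n)`, which bounds the
corresponding Hausdorff sum. -/
theorem exists_cover_MDS (A : Set F) (hA : 2 ≤ A.ncard) (hq : 1 < qc F) (s : ℝ) (n : ℕ) :
    ∃ S : Set (LF F × ℤ), S.Countable ∧ (∀ p ∈ S, p.2 = -(n : ℤ)) ∧
      (MDS F A ⊆ ⋃ p ∈ S, ball F p.1 ((qc F : ℝ) ^ p.2)) ∧
      ∑' p : S, ENNReal.ofReal (((qc F : ℝ) ^ (p : LF F × ℤ).2) ^ s) ≤
        ENNReal.ofReal ((A.ncard * (qc F : ℝ) ^ (-s)) ^ n) := by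
  obtain ⟨a₀, ha₀⟩ : A.Nonempty := Set.nonempty_of_ncard_ne_zero (by omega)
  let center : (Fin n → A) → LF F × ℤ := fun w =>
    (ofDigits F (fun i => if h : i < n then w ⟨i, h⟩ else a₀), -(n : ℤ))
  let T : Finset (LF F × ℤ) := Finset.univ.image center
  have hT : ∀ p ∈ T, p.2 = -(n : ℤ) := by
    intro p hp
    obtain ⟨w, -, rfl⟩ := Finset.mem_image.1 hp
    rfl
  refine ⟨T, T.countable_toSet, fun p hp => hT p hp, fun y hy => ?_, ?_⟩
  · let w : Fin n → A := fun i => ⟨y.coeff (i + 1), hy.2 _ (by omega)⟩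
    refine Set.mem_biUnion (x := center w) (by simp [T]) ?_
    rw [mem_ball_zpow_iff hq]
    intro m hm
    have hm' : m ≤ n := by simpa [center] using hm
    simp only [center, ofDigits_coeff]
    split_ifs with h1 h2
    · simp only [w]
      congr 1
      omega
    · omega
    · exact hy.1 m (by omega)
  · have hcard : T.card ≤ A.ncard ^ n := by
      refine Finset.card_image_le.trans (le_of_eq ?_)
      rw [Finset.card_univ, Fintype.card_fun, Fintype.card_fin, ← Nat.card_eq_fintype_card,
        Nat.card_coe_set_eq]
    have hterm : ∀ p ∈ T, ENNReal.ofReal (((qc F : ℝ) ^ p.2) ^ s) =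
        ENNReal.ofReal (((qc F : ℝ) ^ (-s)) ^ n) := by
      intro p hp
      rw [hT p hp, ← Real.rpow_intCast, ← Real.rpow_mul (by positivity),
        ← Real.rpow_natCast, ← Real.rpow_mul (by positivity)]
      congr 2
      push_cast
      ring
    have hsum : ∑' p : (T : Set (LF F × ℤ)), ENNReal.ofReal (((qc F : ℝ) ^ (p : LF F × ℤ).2) ^ s) =
        ∑ p ∈ T, ENNReal.ofReal (((qc F : ℝ) ^ p.2) ^ s) :=
      Finset.tsum_subtype T fun p => ENNReal.ofReal (((qc F : ℝ) ^ p.2) ^ s)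
    rw [hsum, Finset.sum_congr rfl hterm, Finset.sum_const, nsmul_eq_mul, mul_pow,
      ENNReal.ofReal_mul (by positivity)]
    gcongr
    rw [← Nat.cast_pow, ENNReal.ofReal_natCast]
    exact_mod_cast hcard

theorem hmeas_MDS_le (A : Set F) (hA : 2 ≤ A.ncard) (hq : 1 < qc F) (s : ℝ) {c : ℝ≥0∞}
    (hc : ∀ N : ℕ, ∃ n ≥ N, ENNReal.ofReal ((A.ncard * (qc F : ℝ) ^ (-s)) ^ n) ≤ c) :
    hmeas F (fun r => r ^ s) (MDS F A) ≤ c := by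
  have hq' : (1 : ℝ) < qc F := by exact_mod_cast hq
  refine iSup₂_le fun ρ hρ => ?_
  obtain ⟨N, hN⟩ := exists_pow_lt_of_lt_one hρ (inv_lt_one_of_one_lt₀ hq')
  obtain ⟨n, hn, hnc⟩ := hc N
  obtain ⟨S, hS, hS2, hcov, hsum⟩ := exists_cover_MDS F A hA hq s n
  refine iInf_le_of_le S <| iInf_le_of_le hS <| iInf_le_of_le (fun p hp => ?_) <|
    iInf_le_of_le hcov <| hsum.trans hnc
  rw [hS2 p hp, zpow_neg, zpow_natCast, ← inv_pow]
  exact (pow_le_pow_of_le_one (by positivity) (inv_le_one_of_one_le₀ hq'.le) hn).trans hN.le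

theorem hmeas_MDS_le_one (A : Set F) (hA : 2 ≤ A.ncard) (hq : 1 < qc F) :
    hmeas F (fun r => r ^ gammaA F A) (MDS F A) ≤ 1 := by
  have ha : (A.ncard : ℝ) ≠ 0 := by exact_mod_cast (by omega : A.ncard ≠ 0)
  refine hmeas_MDS_le F A hA hq _ fun N => ⟨N, le_rfl, ?_⟩
  rw [Real.rpow_neg (by positivity), qc_rpow_gammaA F A hA hq, mul_inv_cancel₀ ha]
  simp

theorem hmeas_MDS_eq_zero (A : Set F) (hA : 2 ≤ A.ncard) (hq : 1 < qc F) {s : ℝ}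
    (hs : gammaA F A < s) : hmeas F (fun r => r ^ s) (MDS F A) = 0 := by
  have hq' : (1 : ℝ) < qc F := by exact_mod_cast hq
  have hlt : A.ncard * (qc F : ℝ) ^ (-s) < 1 := by
    rw [← qc_rpow_gammaA F A hA hq, ← Real.rpow_add (by positivity)]
    exact Real.rpow_lt_one_of_one_lt_of_neg hq' (by linarith)
  refine le_antisymm (le_of_forall_gt_imp_ge_of_dense fun c hc => ?_) zero_le
  refine hmeas_MDS_le F A hA hq s fun N => ?_
  have ht : Filter.Tendsto (fun n : ℕ => ENNReal.ofReal ((A.ncard * (qc F : ℝ) ^ (-s)) ^ n))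
      Filter.atTop (nhds 0) := by
    simpa using ENNReal.tendsto_ofReal
      (tendsto_pow_atTop_nhds_zero_of_lt_one (by positivity) hlt)
  obtain ⟨n, hn, hnc⟩ := ((Filter.eventually_ge_atTop N).and (ht.eventually_lt_const hc)).exists
  exact ⟨n, hn, hnc.le⟩

/-- For `𝒜 ⊆ 𝔽_q` with `2 ≤ #𝒜 < q`, the missing digit set `MDS(𝒜)` has
Hausdorff dimension `γ_𝒜 = log #𝒜 / log q` (the dimension being `inf {s > 0 : ℋ^s = 0}`),
and `ℋ^{γ_𝒜}(MDS(𝒜)) = 1`. -/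
theorem mds_dimension_and_measure (A : Set F) (hA1 : 2 ≤ A.ncard) (hA2 : A.ncard < qc F) :
    sInf {s : ℝ | 0 < s ∧ hmeas F (fun r => r ^ s) (MDS F A) = 0} = gammaA F A
    ∧ hmeas F (fun r => r ^ gammaA F A) (MDS F A) = 1 := by
  have hq : 1 < qc F := by omega
  have hγ := gammaA_pos F A hA1 hq
  have hlt : ∀ s < gammaA F A, hmeas F (fun r => r ^ s) (MDS F A) ≠ 0 := fun s hs h => by
    have := one_le_hmeas_MDS F A hA1 hq hs.le
    simp [h] at this
  have hone : hmeas F (fun r => r ^ gammaA F A) (MDS F A) = 1 :=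
    le_antisymm (hmeas_MDS_le_one F A hA1 hq) (one_le_hmeas_MDS F A hA1 hq le_rfl)
  refine ⟨?_, hone⟩
  have hset : {s : ℝ | 0 < s ∧ hmeas F (fun r => r ^ s) (MDS F A) = 0} =
      Set.Ioi (gammaA F A) := by
    ext s
    refine ⟨fun ⟨_, hs⟩ => ?_, fun hs => ⟨hγ.trans hs, hmeas_MDS_eq_zero F A hA1 hq hs⟩⟩
    rcases lt_trichotomy s (gammaA F A) with h | h | h
    · exact absurd hs (hlt s h)
    · rw [h, hone] at hs
      exact absurd hs one_ne_zero
    · exact h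
  rw [hset, csInf_Ioi]
end
end

section
/- Let ψ : {qⁿ : n ∈ ℕ} → ℝ₊ be a non-increasing function such that x ↦ x² ψ(x) is non-increasing and tends to 0 as qⁿ tends to infinity. Then for any c ∈ (0, 1/q), the set (𝒦(ψ) \ 𝒦(cψ)) ∩ MDS(𝒜) is uncountable. -/
/-!
Setting: `𝔽_q((X⁻¹))`, the field of formal Laurent series over the finite field `𝔽_q`
with `q = pⁿ` elements (`F` below is an arbitrary finite field; its cardinality `q` is
automatically a prime power), with absolute value `|f| = q^N` when
`f = ∑_{n ≥ -N} a_{-n} X^{-n}` with `a_N ≠ 0`, and `|0| = 0`.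
We model it as `LaurentSeries F` in the variable `t = X⁻¹`, so the coefficient `a_{-n}` of
`X^{-n}` is the coefficient of `t^n`, and `|f| = q^{-ord_t f}`.
-/

noncomputable section
open scoped ENNReal Classical

variable (F : Type) [Field F] [Fintype F]

section FoldedNumerators

open Polynomial

variable (K : Type*) [Field K]

/-- Numerators of the folded sums: with `n (j + 1) = 2 * n j + k j`, the fraction
`foldNum n k j / X ^ n j` equals `∑ l ≤ j, X ^ (-n l)`. -/
def foldNum (n k : ℕ → ℕ) : ℕ → Polynomial K
  | 0 => 1
  | j + 1 => X ^ (n j + k j) * foldNum n k j + 1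

/-- Polynomials over `K` that lift to integer polynomials. -/
def intPoly : Subring (Polynomial K) :=
  (mapRingHom (Int.castRingHom K)).range

variable {K}
variable {n k : ℕ → ℕ}

lemma X_mem_intPoly : (X : Polynomial K) ∈ intPoly K := ⟨X, by simp⟩

lemma foldNum_mem_intPoly (j : ℕ) : foldNum K n k j ∈ intPoly K := by
  induction j with
  | zero => exact one_mem _
  | succ j ih => exact add_mem (mul_mem (pow_mem X_mem_intPoly _) ih) (one_mem _)

lemma isCoprime_X_pow_foldNum (hn : ∀ j, 0 < n j) (m j : ℕ) :
    IsCoprime (X ^ m : Polynomial K) (foldNum K n k j) := by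
  apply IsCoprime.pow_left
  cases j with
  | zero => exact isCoprime_one_right
  | succ j =>
    have h : n j + k j = (n j + k j - 1) + 1 := by have := hn j; omega
    refine ⟨-(X ^ (n j + k j - 1) * foldNum K n k j), 1, ?_⟩
    rw [foldNum]
    conv_lhs => enter [2, 2, 1, 1]; rw [h]
    ring

lemma strictMono_of_fold (hn0 : 0 < n 0) (hn : ∀ j, n (j + 1) = 2 * n j + k j) :
    StrictMono n := by
  have h : ∀ j, 0 < n j := fun j => by
    induction j with
    | zero => exact hn0
    | succ j ih => rw [hn]; omega
  exact strictMono_nat_of_lt_succ fun j => by rw [hn]; have := h j; omega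

lemma eq_mul_of_foldNum_relation (hn : ∀ j, 0 < n j) {j : ℕ} {h g : Polynomial K}
    (hr : h * foldNum K n k j - g * X ^ n j = 0) :
    ∃ t, h = t * X ^ n j ∧ g = t * foldNum K n k j := by
  have h1 : h * foldNum K n k j = g * X ^ n j := sub_eq_zero.mp hr
  have hd : X ^ n j ∣ h :=
    (isCoprime_X_pow_foldNum hn (n j) j).dvd_of_dvd_mul_right ⟨g, by rw [h1, mul_comm]⟩
  obtain ⟨t, rfl⟩ := hd
  refine ⟨t, mul_comm _ _, ?_⟩
  have hX : (X ^ n j : Polynomial K) ≠ 0 := pow_ne_zero _ X_ne_zero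
  apply mul_right_cancel₀ hX
  rw [← h1]; ring

lemma X_pow_dvd_foldNum_error (hmono : StrictMono n) {i j : ℕ} (hij : i < j) (t : Polynomial K) :
    X ^ n i ∣ t * (X ^ n i * foldNum K n k j - foldNum K n k i * X ^ n j) := by
  apply Dvd.dvd.mul_left
  exact dvd_sub (dvd_mul_right _ _) ((pow_dvd_pow _ (hmono hij).le).mul_left _)

/-- Every good rational approximation to a folded sum is either one of the earlier partial
sums, or occurs at the degree of a reflected copy of an earlier gap. -/
theorem foldNum_approx (hn0 : 0 < n 0) (hn : ∀ j, n (j + 1) = 2 * n j + k j) (j : ℕ) :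
    ∀ h g : Polynomial K, h ≠ 0 → h.natDegree < n j →
      n j ≤ h.natDegree + (h * foldNum K n k j - g * X ^ n j).natDegree + n 0 ∨
      ∃ i < j, ∃ t h₀ g₀ : Polynomial K, h = t * h₀ ∧ g = t * g₀ ∧ h₀ ∈ intPoly K ∧
        g₀ ∈ intPoly K ∧ IsCoprime h₀ g₀ ∧
        n j ≤ h₀.natDegree + (h₀ * foldNum K n k j - g₀ * X ^ n j).natDegree + k i ∧
        ((h₀ = X ^ n i ∧ g₀ = foldNum K n k i) ∨
          n i + n (i + 1) + k (i + 1) ≤ h₀.natDegree) := by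
  have hmono := strictMono_of_fold hn0 hn
  have hpos : ∀ j, 0 < n j := fun j => hn0.trans_le (hmono.monotone (Nat.zero_le j))
  induction j with
  | zero => intro h g _ _; left; omega
  | succ j ih =>
    intro h g hh hd
    set P := foldNum K n k j with hP
    have hP' : foldNum K n k (j + 1) = X ^ (n j + k j) * P + 1 := rfl
    have hXX : (X : Polynomial K) ^ n (j + 1) = X ^ (n j + k j) * X ^ n j := by
      rw [← pow_add, hn]; congr 1; omega
    have herr : ∀ a b : Polynomial K, a * foldNum K n k (j + 1) - b * X ^ n (j + 1) =
        X ^ (n j + k j) * (a * P - b * X ^ n j) + a := fun a b => by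
      rw [hP', hXX]; ring
    have hdeg : ∀ f : Polynomial K, f ≠ 0 →
        (X ^ (n j + k j) * f).natDegree = n j + k j + f.natDegree := fun f hf => by
      rw [natDegree_X_pow_mul _ hf, add_comm]
    rw [hn j] at hd
    simp only [herr]
    simp only [hn j]
    set ρ := h * P - g * X ^ n j with hρ
    by_cases hρ0 : ρ = 0
    · right
      obtain ⟨t, ht1, ht2⟩ := eq_mul_of_foldNum_relation hpos hρ0
      refine ⟨j, Nat.lt_succ_self j, t, X ^ n j, P, ht1, ht2, pow_mem X_mem_intPoly _,
        foldNum_mem_intPoly j, isCoprime_X_pow_foldNum hpos _ _, ?_, Or.inl ⟨rfl, rfl⟩⟩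
      have h1 : (X : Polynomial K) ^ n j * P - P * X ^ n j = 0 := by ring
      rw [h1, mul_zero, zero_add, natDegree_X_pow]; omega
    rcases lt_or_ge h.natDegree (n j + k j) with hd1 | hd1
    · have he : ∀ a f : Polynomial K, f ≠ 0 → a.natDegree < n j + k j →
          (X ^ (n j + k j) * f + a).natDegree = n j + k j + f.natDegree := fun a f hf ha => by
        rw [natDegree_add_eq_left_of_natDegree_lt, hdeg f hf]
        rw [hdeg f hf]; omega
      rw [he h ρ hρ0 hd1]
      rcases lt_or_ge h.natDegree (n j) with hd2 | hd2
      · rcases ih h g hh hd2 with h1 | ⟨i, hi, t, h₀, g₀, e1, e2, m1, m2, hc, hq, ho⟩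
        · left; rw [← hρ] at h1; omega
        · right
          refine ⟨i, hi.trans (Nat.lt_succ_self j), t, h₀, g₀, e1, e2, m1, m2, hc, ?_, ho⟩
          have ht : t ≠ 0 := by rintro rfl; exact hh (by rw [e1, zero_mul])
          have hle : h₀.natDegree ≤ h.natDegree :=
            natDegree_le_of_dvd ⟨t, by rw [e1, mul_comm]⟩ hh
          have hne : h₀ * P - g₀ * X ^ n j ≠ 0 := fun h0 => hρ0 (by
            rw [hρ, e1, e2, mul_assoc, mul_assoc, ← mul_sub, h0, mul_zero])
          rw [he _ _ hne (by omega)]; omega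
      · left; omega
    · set r := X ^ (n j + k j) * ρ + h with hr
      rcases lt_or_ge r.natDegree (n j) with he | he
      swap
      · left; omega
      have hsum : n j + k j + ρ.natDegree = h.natDegree := by
        rw [← hdeg ρ hρ0]
        have : X ^ (n j + k j) * ρ = r - h := by rw [hr]; ring
        rw [this, natDegree_sub_eq_right_of_natDegree_lt]; omega
      have hr0 : r ≠ 0 := by
        intro h0
        have : X ^ (2 * n j + k j) ∣ h := by
          have hd : X ^ n (j + 1) ∣ h * foldNum K n k (j + 1) :=
            ⟨g, by rw [mul_comm _ g]; exact sub_eq_zero.mp (by rw [herr]; exact h0)⟩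
          rw [← hn]
          exact (isCoprime_X_pow_foldNum hpos _ _).dvd_of_dvd_mul_right hd
        have := natDegree_le_of_dvd this hh
        rw [natDegree_X_pow] at this; omega
      have hs : r * P - (X ^ k j * ρ * P + g) * X ^ n j = ρ := by
        rw [hr, hρ, pow_add]; ring
      rcases ih r (X ^ k j * ρ * P + g) hr0 he with
        h1 | ⟨i, hi, t, r₀, s₀, e1, e2, m1, m2, hc, hq, ho⟩
      · left
        rw [hs] at h1; omega
      · right
        set ρ₀ := r₀ * P - s₀ * X ^ n j with hρ₀
        have hρt : ρ = t * ρ₀ := by rw [← hs, e2, hρ₀, e1]; ring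
        have hρ₀0 : ρ₀ ≠ 0 := by intro h0; exact hρ0 (by rw [hρt, h0, mul_zero])
        have hr₀ : r₀.natDegree < n j :=
          (natDegree_le_of_dvd ⟨t, by rw [e1, mul_comm]⟩ hr0).trans_lt he
        have hdh : (r₀ - X ^ (n j + k j) * ρ₀).natDegree = n j + k j + ρ₀.natDegree := by
          rw [natDegree_sub_eq_right_of_natDegree_lt, hdeg _ hρ₀0]
          rw [hdeg _ hρ₀0]; omega
        have hPm : P ∈ intPoly K := foldNum_mem_intPoly j
        have hρm : ρ₀ ∈ intPoly K :=
          sub_mem (mul_mem m1 hPm) (mul_mem m2 (pow_mem X_mem_intPoly _))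
        have hinv : (r₀ - X ^ (n j + k j) * ρ₀) * P - (s₀ - X ^ k j * ρ₀ * P) * X ^ n j = ρ₀ := by
          rw [hρ₀, pow_add]; ring
        refine ⟨i, hi.trans (Nat.lt_succ_self j), t, r₀ - X ^ (n j + k j) * ρ₀,
          s₀ - X ^ k j * ρ₀ * P, ?_, ?_, sub_mem m1 (mul_mem (pow_mem X_mem_intPoly _) hρm),
          sub_mem m2 (mul_mem (mul_mem (pow_mem X_mem_intPoly _) hρm) hPm), ?_, ?_, Or.inr ?_⟩
        · have : h = r - X ^ (n j + k j) * ρ := by rw [hr]; ring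
          rw [this, hρt, e1]; ring
        · have : g = t * s₀ - X ^ k j * ρ * P := by rw [← e2]; ring
          rw [this, hρt]; ring
        · obtain ⟨u, v, huv⟩ := hc
          refine ⟨u * (1 + X ^ (n j + k j) * P) + v * X ^ k j * P ^ 2,
            -(u * X ^ (n j + k j) * X ^ n j) + v * (1 - X ^ k j * X ^ n j * P), ?_⟩
          rw [hρ₀, pow_add]; linear_combination huv
        · rw [hinv, add_sub_cancel, hdh]; omega
        · rw [hdh]
          rcases ho with ⟨rfl, rfl⟩ | ho
          · have h2 : X ^ n i ∣ ρ₀ := by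
              have := X_pow_dvd_foldNum_error (K := K) (k := k) hmono hi 1
              rwa [one_mul] at this
            have h3 := natDegree_le_of_dvd h2 hρ₀0
            rw [natDegree_X_pow] at h3
            have h4 : n (i + 1) + k (i + 1) ≤ n j + k j := by
              rcases Nat.lt_or_ge (i + 1) j with h5 | h5
              · have := hmono.monotone (show i + 1 + 1 ≤ j from h5)
                rw [hn] at this; omega
              · have : i + 1 = j := by omega
                rw [this]
            omega
          · omega

end FoldedNumerators

section LaurentTools

open Polynomial

lemma one_lt_qc : (1 : ℝ) < qc F := by
  unfold qc; exact_mod_cast Fintype.one_lt_card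

lemma qc_pos : (0 : ℝ) < qc F := zero_lt_one.trans (one_lt_qc F)

lemma absv_lt_zpow_iff (f : LF F) (m : ℤ) : absv F f < (qc F : ℝ) ^ (-m) ↔ m < f.orderTop := by
  unfold absv
  split_ifs with hf
  · simpa [hf] using zpow_pos (qc_pos F) (-m)
  · rw [zpow_lt_zpow_iff_right₀ (one_lt_qc F), neg_lt_neg_iff,
      ← HahnSeries.order_eq_orderTop_of_ne_zero hf, WithTop.coe_lt_coe]

lemma absv_le_zpow_iff (f : LF F) (m : ℤ) : absv F f ≤ (qc F : ℝ) ^ (-m) ↔ m ≤ f.orderTop := by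
  unfold absv
  split_ifs with hf
  · simpa [hf] using (zpow_pos (qc_pos F) (-m)).le
  · rw [zpow_le_zpow_iff_right₀ (one_lt_qc F), neg_le_neg_iff,
      ← HahnSeries.order_eq_orderTop_of_ne_zero hf, WithTop.coe_le_coe]

variable (K : Type) [Field K]

lemma le_orderTop_sub {f g : LF K} {a : WithTop ℤ} (hf : a ≤ f.orderTop) (hg : a ≤ g.orderTop) :
    a ≤ (f - g).orderTop :=
  (le_min hf hg).trans HahnSeries.min_orderTop_le_orderTop_sub

lemma XL_pow_mul_coeff (N : ℕ) (f : LF K) (m : ℤ) : (XL K ^ N * f).coeff m = f.coeff (m + N) := by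
  rw [XL, HahnSeries.single_pow, one_pow, HahnSeries.coeff_single_mul, one_mul]
  simp

lemma toL_C (a : K) : toL K (C a) = HahnSeries.C a := by
  rw [toL, aeval_C, HahnSeries.algebraMap_apply', PowerSeries.algebraMap_apply,
    HahnSeries.ofPowerSeries_C]; rfl

lemma toL_X : toL K X = XL K := aeval_X _

lemma toL_mul (g h : K[X]) : toL K (g * h) = toL K g * toL K h := map_mul (aeval (XL K)) g h

lemma toL_add (g h : K[X]) : toL K (g + h) = toL K g + toL K h := map_add (aeval (XL K)) g h

lemma toL_sub (g h : K[X]) : toL K (g - h) = toL K g - toL K h := map_sub (aeval (XL K)) g h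

lemma toL_one : toL K 1 = 1 := map_one (aeval (XL K))

lemma toL_pow (g : K[X]) (N : ℕ) : toL K (g ^ N) = toL K g ^ N := map_pow (aeval (XL K)) g N

lemma toL_coeff (g : K[X]) (m : ℤ) :
    (toL K g).coeff m = if m ≤ 0 then g.coeff (-m).toNat else 0 := by
  induction g using Polynomial.induction_on' with
  | add p r hp hr =>
    rw [toL_add, HahnSeries.coeff_add, hp, hr]
    split_ifs <;> simp
  | monomial d a =>
    rw [← C_mul_X_pow_eq_monomial, toL_mul, toL_pow, toL_C, toL_X, mul_comm, XL_pow_mul_coeff,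
      HahnSeries.C_apply, HahnSeries.coeff_single, coeff_C_mul_X_pow]
    split_ifs <;> first | rfl | omega

lemma orderTop_toL {g : K[X]} (hg : g ≠ 0) :
    (toL K g).orderTop = ((-(g.natDegree : ℤ) : ℤ) : WithTop ℤ) := by
  apply le_antisymm
  · apply HahnSeries.orderTop_le_of_coeff_ne_zero
    rw [toL_coeff, if_pos (by omega)]
    simpa using hg
  · rw [HahnSeries.le_orderTop_iff_forall]
    intro m hm
    rw [WithTop.coe_lt_coe] at hm
    rw [toL_coeff]
    split_ifs
    · exact coeff_eq_zero_of_natDegree_lt (by omega)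
    · rfl

lemma toL_ne_zero {g : K[X]} (hg : g ≠ 0) : toL K g ≠ 0 := by
  intro h
  have := orderTop_toL K hg
  rw [h, HahnSeries.orderTop_zero] at this
  exact WithTop.top_ne_coe this

lemma le_orderTop_toL_mul {h : K[X]} (hh : h ≠ 0) (f : LF K) (m : ℤ) :
    (m : WithTop ℤ) ≤ (toL K h * f).orderTop ↔
      ((m + h.natDegree : ℤ) : WithTop ℤ) ≤ f.orderTop := by
  rw [HahnSeries.orderTop_mul, orderTop_toL K hh]
  cases f.orderTop with
  | top => simp
  | coe a =>
    rw [← WithTop.coe_add, WithTop.coe_le_coe, WithTop.coe_le_coe]; omega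

lemma le_orderTop_sub_div {h : K[X]} (hh : h ≠ 0) (g : K[X]) (ξ : LF K) (m : ℤ) :
    (m : WithTop ℤ) ≤ (ξ - toL K g / toL K h).orderTop ↔
      ((m - h.natDegree : ℤ) : WithTop ℤ) ≤ (toL K h * ξ - toL K g).orderTop := by
  have h0 := toL_ne_zero K hh
  have : toL K h * ξ - toL K g = toL K h * (ξ - toL K g / toL K h) := by field_simp
  rw [this, le_orderTop_toL_mul K hh, sub_add_cancel]

end LaurentTools

section DigitSeries

open Polynomial

variable (K : Type) [Field K]

/-- The series `∑ t ^ m` over the positive `m` in `S`. -/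
def setSeries (S : Set ℕ) : LF K :=
  HahnSeries.ofSuppBddBelow (fun m : ℤ => if 0 < m ∧ m.toNat ∈ S then (1 : K) else 0)
    ⟨0, fun m hm => (by by_contra h; exact hm (if_neg (by omega)))⟩

lemma setSeries_coeff (S : Set ℕ) (m : ℤ) :
    (setSeries K S).coeff m = if 0 < m ∧ m.toNat ∈ S then (1 : K) else 0 := rfl

lemma le_orderTop_setSeries (S : Set ℕ) (N : ℕ) (hS : ∀ m ∈ S, N ≤ m) :
    ((N : ℤ) : WithTop ℤ) ≤ (setSeries K S).orderTop := by
  rw [HahnSeries.le_orderTop_iff_forall]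
  intro m hm
  rw [WithTop.coe_lt_coe] at hm
  rw [setSeries_coeff, if_neg]
  rintro ⟨h0, h1⟩
  have := hS _ h1
  omega

lemma setSeries_univ : (XL K - 1) * setSeries K Set.univ = 1 := by
  ext m
  rw [sub_mul, one_mul, HahnSeries.coeff_sub, ← pow_one (XL K), XL_pow_mul_coeff,
    setSeries_coeff, setSeries_coeff, HahnSeries.coeff_one]
  simp only [Set.mem_univ, and_true]
  split_ifs <;> first | omega | simp

/-- The series `∑ t ^ n l` over `l ≥ i`. -/
def tailSeries (n : ℕ → ℕ) (i : ℕ) : LF K := setSeries K (n '' Set.Ici i)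

variable {n k : ℕ → ℕ}

lemma le_orderTop_tailSeries (hmono : StrictMono n) (i : ℕ) :
    ((n i : ℤ) : WithTop ℤ) ≤ (tailSeries K n i).orderTop := by
  apply le_orderTop_setSeries
  rintro _ ⟨l, hl, rfl⟩
  exact hmono.monotone hl

lemma XL_pow_mul_tailSeries (hmono : StrictMono n) (h0 : ∀ j, 0 < n j) (i : ℕ) :
    XL K ^ n i * tailSeries K n i = 1 + XL K ^ n i * tailSeries K n (i + 1) := by
  ext m
  rw [HahnSeries.coeff_add, XL_pow_mul_coeff, XL_pow_mul_coeff, tailSeries,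
    tailSeries, setSeries_coeff, setSeries_coeff, HahnSeries.coeff_one]
  have key : (m + n i).toNat ∈ n '' Set.Ici i ↔
      (m + n i).toNat = n i ∨ (m + n i).toNat ∈ n '' Set.Ici (i + 1) := by
    constructor
    · rintro ⟨l, hl, he⟩
      rcases Nat.eq_or_lt_of_le (show i ≤ l from hl) with rfl | h
      · exact Or.inl he.symm
      · exact Or.inr ⟨l, h, he⟩
    · rintro (h | ⟨l, hl, he⟩)
      · exact ⟨i, le_refl i, h.symm⟩
      · exact ⟨l, (Nat.le_succ i).trans hl, he⟩
  have hi := h0 i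
  by_cases hm : m = 0
  · subst hm
    have hnot : ((0 : ℤ) + n i).toNat ∉ n '' Set.Ici (i + 1) := by
      rintro ⟨l, hl, he⟩
      have := hmono (Nat.lt_of_succ_le hl)
      omega
    rw [if_pos ⟨by omega, key.mpr (Or.inl (by omega))⟩, if_pos rfl, if_neg fun h => hnot h.2,
      add_zero]
  · rw [if_neg hm, zero_add]
    congr 1
    rw [key]
    apply propext
    constructor
    · rintro ⟨h1, h2 | h2⟩
      · omega
      · exact ⟨h1, h2⟩
    · rintro ⟨h1, h2⟩
      exact ⟨h1, Or.inr h2⟩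

lemma toL_foldNum (hn0 : 0 < n 0) (hn : ∀ j, n (j + 1) = 2 * n j + k j) (i : ℕ) :
    toL K (foldNum K n k i) = XL K ^ n i * (tailSeries K n 0 - tailSeries K n (i + 1)) := by
  have hmono := strictMono_of_fold hn0 hn
  have hpos : ∀ j, 0 < n j := fun j => hn0.trans_le (hmono.monotone (Nat.zero_le j))
  induction i with
  | zero =>
    rw [foldNum, toL_one, mul_sub, XL_pow_mul_tailSeries K hmono hpos]; ring
  | succ i ih =>
    rw [foldNum, toL_add, toL_mul, toL_pow, toL_X, ih, toL_one, ← mul_assoc, ← pow_add,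
      show n i + k i + n i = n (i + 1) by rw [hn]; ring, mul_sub,
      XL_pow_mul_tailSeries K hmono hpos (i + 1)]
    ring

end DigitSeries

section FoldedSeries

open Polynomial

variable {K : Type} [Field K]

lemma exists_int_eval_one {h : K[X]} (hh : h ∈ intPoly K) : ∃ x : ℤ, h.eval 1 = x := by
  obtain ⟨f, rfl⟩ := hh
  refine ⟨f.eval 1, ?_⟩
  rw [coe_mapRingHom, eval_one_map]
  rfl

lemma derivative_mem_intPoly {h : K[X]} (hh : h ∈ intPoly K) : derivative h ∈ intPoly K := by
  obtain ⟨f, rfl⟩ := hh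
  exact ⟨derivative f, (derivative_map f _).symm⟩

lemma exists_eq_X_sub_one_mul {f : K[X]} (hf : f.eval 1 = 0) : ∃ s, f = (X - 1) * s := by
  obtain ⟨s, hs⟩ := dvd_iff_isRoot.mpr hf
  exact ⟨s, by rw [hs, C_1]⟩

lemma X_sub_one_ne_zero : (X - 1 : K[X]) ≠ 0 := by
  rw [← C_1]; exact X_sub_C_ne_zero 1

lemma natDegree_X_sub_one_mul {f : K[X]} (hf : f ≠ 0) :
    ((X - 1) * f).natDegree = f.natDegree + 1 := by
  rw [natDegree_mul X_sub_one_ne_zero hf, ← C_1, natDegree_X_sub_C, add_comm]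

variable (K) in
/-- The series `b / (X - 1) + ∑ t ^ n l`. -/
def foldSeries (b : K) (n : ℕ → ℕ) : LF K :=
  toL K (C b) * setSeries K Set.univ + tailSeries K n 0

variable {n k : ℕ → ℕ} {b : K} {κ : ℕ → ℕ} {σ : ℕ}

lemma toL_X_sub_one_mul_foldSeries :
    toL K (X - 1) * foldSeries K b n = toL K (C b) + toL K (X - 1) * tailSeries K n 0 := by
  have h := setSeries_univ K
  rw [toL_sub, toL_X, toL_one, foldSeries]
  linear_combination toL K (C b) * h

/-- Residues at a far enough partial sum control the approximations to `foldSeries`. -/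
lemma natDegree_residue_le (hn0 : 0 < n 0) (hn : ∀ j, n (j + 1) = 2 * n j + k j)
    {h g : K[X]} (hh : h ≠ 0) {e : ℕ}
    (he : ((h.natDegree + e + 1 : ℤ) : WithTop ℤ) ≤
      (toL K h * foldSeries K b n - toL K g).orderTop)
    {j : ℕ} (hj : h.natDegree + 1 < n j) :
    ((X - 1) * h * foldNum K n k j - (g * (X - 1) - C b * h) * X ^ n j) ≠ 0 ∧
      ((X - 1) * h * foldNum K n k j - (g * (X - 1) - C b * h) * X ^ n j).natDegree +
        h.natDegree + e ≤ n j := by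
  have hmono := strictMono_of_fold hn0 hn
  have hpos : ∀ j, 0 < n j := fun j => hn0.trans_le (hmono.monotone (Nat.zero_le j))
  have hd := natDegree_X_sub_one_mul hh
  have hX0 : (X - 1) * h ≠ 0 := mul_ne_zero X_sub_one_ne_zero hh
  set r := (X - 1) * h * foldNum K n k j - (g * (X - 1) - C b * h) * X ^ n j with hr
  have hr0 : r ≠ 0 := by
    intro h0
    obtain ⟨t, ht, -⟩ := eq_mul_of_foldNum_relation hpos h0
    have := natDegree_le_of_dvd (⟨t, by rw [ht, mul_comm]⟩ : X ^ n j ∣ (X - 1) * h) hX0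
    rw [natDegree_X_pow] at this
    omega
  refine ⟨hr0, ?_⟩
  have hXn : (X ^ n j * (X - 1) : K[X]) ≠ 0 :=
    mul_ne_zero (pow_ne_zero _ X_ne_zero) X_sub_one_ne_zero
  have hXnd : (X ^ n j * (X - 1) : K[X]).natDegree = n j + 1 := by
    rw [mul_comm, natDegree_X_sub_one_mul (pow_ne_zero _ X_ne_zero), natDegree_X_pow]
  have key : toL K r = toL K (X ^ n j * (X - 1)) * (toL K h * foldSeries K b n - toL K g) -
      toL K (X ^ n j * ((X - 1) * h)) * tailSeries K n (j + 1) := by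
    have h1 := toL_X_sub_one_mul_foldSeries (b := b) (n := n)
    have h2 := toL_foldNum K hn0 hn j
    rw [← toL_X, ← toL_pow] at h2
    rw [hr]
    simp only [toL_sub, toL_mul] at h1 ⊢
    linear_combination toL K (X ^ n j) * (-toL K h) * h1 + (toL K X - toL K 1) * toL K h * h2
  have o1 : ((h.natDegree + e - n j : ℤ) : WithTop ℤ) ≤
      (toL K (X ^ n j * (X - 1)) * (toL K h * foldSeries K b n - toL K g)).orderTop := by
    rw [le_orderTop_toL_mul K hXn, hXnd]
    convert he using 2
    push_cast; ring
  have hXn' : (X ^ n j * ((X - 1) * h) : K[X]) ≠ 0 := mul_ne_zero (pow_ne_zero _ X_ne_zero) hX0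
  have o2 : ((1 : ℤ) : WithTop ℤ) ≤
      (toL K (X ^ n j * ((X - 1) * h)) * tailSeries K n (j + 1)).orderTop := by
    rw [le_orderTop_toL_mul K hXn']
    refine le_trans ?_ (le_orderTop_tailSeries K hmono (j + 1))
    rw [WithTop.coe_le_coe, natDegree_mul (pow_ne_zero _ X_ne_zero) hX0, natDegree_X_pow, hd, hn]
    push_cast
    omega
  have o3 := (min_le_min o1 o2).trans HahnSeries.min_orderTop_le_orderTop_sub
  rw [← key, orderTop_toL K hr0, ← WithTop.coe_min, WithTop.coe_le_coe] at o3
  omega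

/-- Rational approximations to `foldSeries` cannot be better than the bound `κ` that its gaps
were tuned to. -/
theorem not_le_orderTop_foldSeries (hn0 : 0 < n 0) (hn : ∀ j, n (j + 1) = 2 * n j + k j)
    (hb : b ≠ 0) (hκ : Monotone κ)
    (hσ : σ = 1 ∨ σ = 0 ∧ ∀ x y : ℤ, (x : K) + b * y = 0 → (x : K) = 0)
    {c : ℕ} (hk : ∀ i, k i ≤ c ∨ k i ≤ κ (n i + 1) + 2 ∧
      k i + 2 * σ ≤ κ (n i + (n (i + 1) + k (i + 1)) - σ))
    {h : K[X]} (g : K[X]) (hh : h ≠ 0) (hlarge : n 0 + c + 2 ≤ κ h.natDegree) :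
    ¬ ((h.natDegree + κ h.natDegree + 1 : ℤ) : WithTop ℤ) ≤
      (toL K h * foldSeries K b n - toL K g).orderTop := by
  intro he
  have hmono := strictMono_of_fold hn0 hn
  have hj : h.natDegree + 1 < n (h.natDegree + 2) := lt_of_lt_of_le (by omega) hmono.le_apply
  set j := h.natDegree + 2
  obtain ⟨hr0, hr⟩ := natDegree_residue_le hn0 hn hh he hj
  have hd := natDegree_X_sub_one_mul hh
  have hX0 : (X - 1) * h ≠ 0 := mul_ne_zero X_sub_one_ne_zero hh
  rcases foldNum_approx hn0 hn j ((X - 1) * h) (g * (X - 1) - C b * h) hX0 (by omega) with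
    h1 | ⟨i, -, t, h₀, g₀, e1, e2, m1, m2, hc, hq, ho⟩
  · omega
  have ht : t ≠ 0 := by rintro rfl; exact hX0 (by rw [e1, zero_mul])
  have hh₀ : h₀ ≠ 0 := by rintro rfl; exact hX0 (by rw [e1, mul_zero])
  have hdt : h.natDegree + 1 = t.natDegree + h₀.natDegree := by
    rw [← hd, e1, natDegree_mul ht hh₀]
  have hrt : (X - 1) * h * foldNum K n k j - (g * (X - 1) - C b * h) * X ^ n j =
      t * (h₀ * foldNum K n k j - g₀ * X ^ n j) := by rw [e1, e2]; ring
  rw [hrt] at hr hr0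
  rw [natDegree_mul ht (right_ne_zero_of_mul hr0)] at hr
  rcases hk i with hki | ⟨hk1, hk2⟩
  · omega
  rcases ho with ⟨rfl, rfl⟩ | ho
  · have v1 := congrArg (eval 1) e1
    simp at v1
    obtain ⟨s, rfl⟩ := exists_eq_X_sub_one_mul v1.symm
    have hs : h = s * X ^ n i := by
      apply mul_left_cancel₀ (X_sub_one_ne_zero (K := K))
      rw [e1]; ring
    have v2 := congrArg (eval 1) e2
    simp [hb, hs] at v2
    obtain ⟨u, rfl⟩ := exists_eq_X_sub_one_mul v2
    have hu : u ≠ 0 := by rintro rfl; simp at ht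
    have h3 : h.natDegree = u.natDegree + 1 + n i := by
      rw [hs, natDegree_mul (mul_ne_zero X_sub_one_ne_zero hu) (pow_ne_zero _ X_ne_zero),
        natDegree_X_sub_one_mul hu, natDegree_X_pow]
    have h4 : κ (n i + 1) ≤ κ h.natDegree := hκ (by omega)
    rw [natDegree_X_sub_one_mul (mul_ne_zero X_sub_one_ne_zero hu),
      natDegree_X_sub_one_mul hu] at hr hdt
    omega
  · rcases hσ with rfl | ⟨rfl, hσ⟩
    · have h4 : κ (n i + (n (i + 1) + k (i + 1)) - 1) ≤ κ h.natDegree := hκ (by omega)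
      omega
    · have htd : t.natDegree ≠ 0 := by
        intro h0
        obtain ⟨τ, rfl⟩ := natDegree_eq_zero.mp h0
        have hτ : τ ≠ 0 := by rintro rfl; simp at ht
        have v1 := congrArg (eval 1) e1
        simp [hτ] at v1
        obtain ⟨w, rfl⟩ := exists_eq_X_sub_one_mul v1
        have hw : h = C τ * w := by
          apply mul_left_cancel₀ (X_sub_one_ne_zero (K := K))
          rw [e1]; ring
        have v2 := congrArg (eval 1) e2
        simp [hw] at v2
        obtain ⟨x, hx⟩ := exists_int_eval_one m2
        obtain ⟨y, hy⟩ := exists_int_eval_one (derivative_mem_intPoly m1)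
        simp at hy
        have hx0 : (x : K) = 0 := by
          apply hσ x y
          rw [← hx, ← hy]
          apply mul_left_cancel₀ hτ
          linear_combination -v2
        obtain ⟨u, v, huv⟩ := hc
        have := congrArg (eval 1) huv
        simp [hx, hx0] at this
      have h4 : κ (n i + (n (i + 1) + k (i + 1)) - 0) ≤ κ h.natDegree := hκ (by omega)
      omega

lemma exists_approx_of_gap (hn0 : 0 < n 0) (hn : ∀ j, n (j + 1) = 2 * n j + k j)
    {i : ℕ} (hk : k i = κ (n i + 1) + 2) :
    ∃ h g : K[X], h ≠ 0 ∧ n i ≤ h.natDegree ∧ ((h.natDegree + κ h.natDegree : ℤ) : WithTop ℤ) ≤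
      (toL K h * foldSeries K b n - toL K g).orderTop := by
  have hmono := strictMono_of_fold hn0 hn
  have hX : (X ^ n i : K[X]) ≠ 0 := pow_ne_zero _ X_ne_zero
  have hd : ((X - 1) * X ^ n i : K[X]).natDegree = n i + 1 := by
    rw [natDegree_X_sub_one_mul hX, natDegree_X_pow]
  have h0 : ((X - 1) * X ^ n i : K[X]) ≠ 0 := mul_ne_zero X_sub_one_ne_zero hX
  refine ⟨(X - 1) * X ^ n i, C b * X ^ n i + (X - 1) * foldNum K n k i, h0, by omega, ?_⟩
  have key : toL K ((X - 1) * X ^ n i) * foldSeries K b n -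
      toL K (C b * X ^ n i + (X - 1) * foldNum K n k i) =
      toL K ((X - 1) * X ^ n i) * tailSeries K n (i + 1) := by
    have h1 := toL_X_sub_one_mul_foldSeries (b := b) (n := n)
    have h2 := toL_foldNum K hn0 hn i
    rw [← toL_X, ← toL_pow] at h2
    simp only [toL_sub, toL_mul, toL_add] at h1 ⊢
    linear_combination toL K (X ^ n i) * h1 - (toL K X - toL K 1) * h2
  rw [key, le_orderTop_toL_mul K h0]
  refine le_trans ?_ (le_orderTop_tailSeries K hmono (i + 1))
  rw [WithTop.coe_le_coe, hd, hn, hk]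
  push_cast
  omega

lemma X_pow_sub_one_ne_zero {N : ℕ} (hN : 0 < N) : (X ^ N - 1 : K[X]) ≠ 0 := by
  rw [← C_1]; exact X_pow_sub_C_ne_zero hN 1

lemma le_orderTop_copy (hn0 : 0 < n 0) (hn : ∀ j, n (j + 1) = 2 * n j + k j) (i : ℕ) :
    ((n i + k i + (n (i + 1) + k (i + 1) : ℕ) : ℤ) : WithTop ℤ) ≤
      (toL K ((X ^ (n (i + 1) + k (i + 1)) - 1) * X ^ n i) * foldSeries K b n -
        toL K (C b * (∑ m ∈ Finset.range (n (i + 1) + k (i + 1)), X ^ m) * X ^ n i +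
          (X ^ (n (i + 1) + k (i + 1)) - 1) * foldNum K n k i + X ^ (n i + k (i + 1)))).orderTop := by
  have hmono := strictMono_of_fold hn0 hn
  have hpos : ∀ j, 0 < n j := fun j => hn0.trans_le (hmono.monotone (Nat.zero_le j))
  set N := n (i + 1) + k (i + 1) with hN
  have hn2 : n (i + 2) = n (i + 1) + N := by rw [hn]; omega
  have hn3 : n (i + 3) = 2 * n (i + 2) + k (i + 2) := hn _
  have hn1 := hn i
  set G : K[X] := ∑ m ∈ Finset.range N, X ^ m with hG
  have hgeom : (X ^ N - 1 : K[X]) = G * (X - 1) := (geom_sum_mul X N).symm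
  have hX : ∀ m, (X ^ m : K[X]) ≠ 0 := fun m => pow_ne_zero _ X_ne_zero
  have hN0 : 0 < N := by have := hpos (i + 1); omega
  have hXN := X_pow_sub_one_ne_zero (K := K) hN0
  have key : toL K (X ^ n (i + 2)) * (toL K ((X ^ N - 1) * X ^ n i) * foldSeries K b n -
        toL K (C b * G * X ^ n i + (X ^ N - 1) * foldNum K n k i + X ^ (n i + k (i + 1)))) =
      toL K (X ^ (n (i + 2) + n i) * (X ^ N - 1)) * tailSeries K n (i + 3) - toL K (X ^ n i) := by
    have h1 := toL_X_sub_one_mul_foldSeries (b := b) (n := n)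
    have h2 := toL_foldNum K hn0 hn i
    have h3 := XL_pow_mul_tailSeries K hmono hpos (i + 1)
    have h4 := XL_pow_mul_tailSeries K hmono hpos (i + 2)
    have e1 : toL K X ^ N - 1 = toL K G * (toL K X - 1) := by
      have := congrArg (toL K) hgeom
      simpa only [toL_sub, toL_mul, toL_pow, toL_one] using this
    have e2 : XL K ^ (n i + k (i + 1)) * XL K ^ n (i + 1) = XL K ^ n i * XL K ^ N := by
      rw [← pow_add, ← pow_add]; congr 1; omega
    have e3 : XL K ^ n (i + 2) = XL K ^ n (i + 1) * XL K ^ N := by rw [← pow_add, hn2]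
    rw [e3] at h4
    simp only [toL_sub, toL_mul, toL_add, toL_pow, toL_one, toL_X] at h1 e1 ⊢
    rw [pow_add _ (n (i + 2)) (n i), e3]
    generalize XL K ^ n (i + 1) = B at *
    generalize XL K ^ N = D at *
    generalize XL K ^ n i = A at *
    linear_combination B * D * A * (foldSeries K b n - tailSeries K n 0) * e1 +
      B * D * toL K G * A * h1 - B * D * (D - 1) * h2 - D * e2 + D * (D - 1) * A * h3 +
      (D - 1) * A * h4
  have hd : (X ^ (n (i + 2) + n i) * (X ^ N - 1) : K[X]).natDegree = n (i + 2) + n i + N := by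
    rw [natDegree_mul (hX _) hXN, natDegree_X_pow, ← C_1, natDegree_X_pow_sub_C]
  have o1 : ((-n i : ℤ) : WithTop ℤ) ≤
      (toL K (X ^ (n (i + 2) + n i) * (X ^ N - 1)) * tailSeries K n (i + 3)).orderTop := by
    rw [le_orderTop_toL_mul K (mul_ne_zero (hX _) hXN), hd]
    refine le_trans ?_ (le_orderTop_tailSeries K hmono (i + 3))
    rw [WithTop.coe_le_coe]
    push_cast
    omega
  have o2 : ((-n i : ℤ) : WithTop ℤ) ≤ (toL K (X ^ n i)).orderTop := by
    rw [orderTop_toL K (hX _), natDegree_X_pow]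
  have o3 := le_orderTop_sub K o1 o2
  rw [← key, le_orderTop_toL_mul K (hX _), natDegree_X_pow] at o3
  refine le_trans ?_ o3
  rw [WithTop.coe_le_coe]
  omega

lemma exists_approx_of_copy (hn0 : 0 < n 0) (hn : ∀ j, n (j + 1) = 2 * n j + k j)
    {i : ℕ} (hσ : σ = 0 ∨ σ = 1 ∧ b * (n (i + 1) + k (i + 1) : ℕ) + 1 = 0)
    (hk : k i + 2 * σ = κ (n i + (n (i + 1) + k (i + 1)) - σ)) :
    ∃ h g : K[X], h ≠ 0 ∧ n i ≤ h.natDegree ∧ ((h.natDegree + κ h.natDegree : ℤ) : WithTop ℤ) ≤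
      (toL K h * foldSeries K b n - toL K g).orderTop := by
  have hcopy := le_orderTop_copy (b := b) hn0 hn i
  have hmono := strictMono_of_fold hn0 hn
  have hN0 : 0 < n (i + 1) + k (i + 1) := by
    have := hn0.trans_le (hmono.monotone (Nat.zero_le (i + 1))); omega
  set N := n (i + 1) + k (i + 1) with hN
  set h := (X ^ N - 1 : K[X]) * X ^ n i with hh
  set g := (C b * (∑ m ∈ Finset.range N, X ^ m) * X ^ n i +
          (X ^ N - 1) * foldNum K n k i + X ^ (n i + k (i + 1)) : K[X]) with hg
  have h0 : h ≠ 0 := mul_ne_zero (X_pow_sub_one_ne_zero hN0) (pow_ne_zero _ X_ne_zero)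
  have hd : h.natDegree = n i + N := by
    rw [hh, natDegree_mul (X_pow_sub_one_ne_zero hN0) (pow_ne_zero _ X_ne_zero), natDegree_X_pow,
      ← C_1, natDegree_X_pow_sub_C, add_comm]
  rcases hσ with rfl | ⟨rfl, hσ⟩
  · refine ⟨h, g, h0, by omega, le_trans ?_ hcopy⟩
    rw [WithTop.coe_le_coe, hd]
    rw [Nat.sub_zero] at hk
    omega
  · obtain ⟨u, hu⟩ := exists_eq_X_sub_one_mul (f := h) (by simp [hh])
    obtain ⟨v, hv⟩ := exists_eq_X_sub_one_mul (f := g) (by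
      simp [hg, eval_finsetSum]; simpa using hσ)
    have hu0 : u ≠ 0 := by rintro rfl; exact h0 (by rw [hu, mul_zero])
    have hud : u.natDegree + 1 = n i + N := by rw [← hd, hu, natDegree_X_sub_one_mul hu0]
    refine ⟨u, v, hu0, by omega, ?_⟩
    rw [hu, hv, toL_mul, toL_mul, mul_assoc, ← mul_sub, le_orderTop_toL_mul K X_sub_one_ne_zero]
      at hcopy
    refine le_trans ?_ hcopy
    rw [WithTop.coe_le_coe, ← C_1, natDegree_X_sub_C, show u.natDegree = n i + N - 1 by omega]
    push_cast
    omega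

end FoldedSeries

section GapSelection

variable {κ : ℕ → ℕ} {p σ : ℕ}

lemma exists_modEq_mem_Ico (hp : 0 < p) (ν m : ℕ) : ∃ N, m ≤ N ∧ N < m + p ∧ N ≡ ν [MOD p] := by
  have := Nat.mod_lt (ν + (p - 1) * m) hp
  refine ⟨m + (ν + (p - 1) * m) % p, by omega, by omega, ?_⟩
  have h : m + (ν + (p - 1) * m) = ν + p * m := by
    obtain ⟨r, rfl⟩ := Nat.exists_eq_add_of_lt hp
    rw [zero_add, Nat.add_sub_cancel]; ring
  calc m + (ν + (p - 1) * m) % p ≡ m + (ν + (p - 1) * m) [MOD p] :=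
        Nat.ModEq.add_left _ (Nat.mod_modEq _ _)
    _ = ν + p * m := h
    _ ≡ ν [MOD p] := by simp [Nat.ModEq]

/-- A gap `k` and a period `N` that are extremal for the bound `κ`, with `N` in a prescribed
residue class and in the `e`-th window of length `p`. -/
lemma exists_gap_period (hκ : Monotone κ) (hp : 0 < p) (hσ : σ ≤ 1) (ν e : ℕ) {n : ℕ} (hn : 0 < n)
    (hnκ : 2 * σ ≤ κ n) :
    ∃ k N, 2 * n + k + p * e ≤ N ∧ N < 2 * n + k + p * e + p ∧ N ≡ ν [MOD p] ∧
      k ≤ κ (n + 1) + 2 ∧ k + 2 * σ ≤ κ (n + N - σ) ∧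
      (k = κ (n + 1) + 2 ∨ k + 2 * σ = κ (n + N - σ)) := by
  let Q : ℕ → Prop := fun k => ∃ N, 2 * n + k + p * e ≤ N ∧ N < 2 * n + k + p * e + p ∧
    N ≡ ν [MOD p] ∧ k + 2 * σ ≤ κ (n + N - σ)
  have h0 : Q 0 := by
    obtain ⟨N, h1, h2, h3⟩ := exists_modEq_mem_Ico hp ν (2 * n + 0 + p * e)
    refine ⟨N, h1, h2, h3, ?_⟩
    have : κ n ≤ κ (n + N - σ) := hκ (by omega)
    omega
  have hQ : Q (Nat.findGreatest Q (κ (n + 1) + 2)) :=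
    Nat.findGreatest_spec (Nat.zero_le _) h0
  have hle := Nat.findGreatest_le (P := Q) (κ (n + 1) + 2)
  have hmax : ∀ k, Nat.findGreatest Q (κ (n + 1) + 2) < k → k ≤ κ (n + 1) + 2 → ¬ Q k :=
    fun k => Nat.findGreatest_is_greatest
  generalize Nat.findGreatest Q (κ (n + 1) + 2) = k at hQ hle hmax
  obtain ⟨N, h1, h2, h3, h4⟩ := hQ
  refine ⟨k, N, h1, h2, h3, hle, h4, ?_⟩
  by_contra! hne
  apply hmax (k + 1) (Nat.lt_succ_self k) (by omega)
  rcases Nat.lt_or_ge N (2 * n + (k + 1) + p * e) with h5 | h5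
  · refine ⟨N + p, by omega, by omega, by simpa [Nat.ModEq] using h3, ?_⟩
    have : κ (n + N - σ) ≤ κ (n + (N + p) - σ) := hκ (by omega)
    omega
  · exact ⟨N, h5, by omega, h3, by omega⟩

/-- Gap sequences whose even entries are extremal for `κ` and whose odd entries encode `w`. -/
lemma exists_fold_sequence (hκ : Monotone κ) (hp : 0 < p) (hσ : σ ≤ 1) (ν : ℕ) {n₀ : ℕ}
    (hn₀ : 0 < n₀) (hnκ : 2 * σ ≤ κ n₀) (w : ℕ → ℕ) :
    ∃ n k : ℕ → ℕ, n 0 = n₀ ∧ (∀ j, n (j + 1) = 2 * n j + k j) ∧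
      (∀ i, p * w i ≤ k (2 * i + 1) ∧ k (2 * i + 1) < p * w i + p) ∧
      ∀ i, n (2 * i + 1) + k (2 * i + 1) ≡ ν [MOD p] ∧ k (2 * i) ≤ κ (n (2 * i) + 1) + 2 ∧
        k (2 * i) + 2 * σ ≤ κ (n (2 * i) + (n (2 * i + 1) + k (2 * i + 1)) - σ) ∧
        (k (2 * i) = κ (n (2 * i) + 1) + 2 ∨
          k (2 * i) + 2 * σ = κ (n (2 * i) + (n (2 * i + 1) + k (2 * i + 1)) - σ)) := by
  have hsel : ∀ m e : ℕ, ∃ r : ℕ × ℕ, n₀ ≤ m → 2 * m + r.1 + p * e ≤ r.2 ∧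
      r.2 < 2 * m + r.1 + p * e + p ∧ r.2 ≡ ν [MOD p] ∧
      r.1 ≤ κ (m + 1) + 2 ∧ r.1 + 2 * σ ≤ κ (m + r.2 - σ) ∧
      (r.1 = κ (m + 1) + 2 ∨ r.1 + 2 * σ = κ (m + r.2 - σ)) := fun m e => by
    by_cases hm : n₀ ≤ m
    · obtain ⟨k, N, h⟩ := exists_gap_period hκ hp hσ ν e (hn₀.trans_le hm) (hnκ.trans (hκ hm))
      exact ⟨(k, N), fun _ => h⟩
    · exact ⟨(0, 0), fun h => absurd h hm⟩
  choose r hr using hsel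
  let E : ℕ → ℕ := fun i =>
    Nat.rec n₀ (fun i m => 2 * m + (r m (w i)).1 + (r m (w i)).2) i
  have hE : ∀ i, E (i + 1) = 2 * E i + (r (E i) (w i)).1 + (r (E i) (w i)).2 := fun i => rfl
  have hE0 : ∀ i, n₀ ≤ E i := fun i => by
    induction i with
    | zero => exact le_refl n₀
    | succ i ih => rw [hE]; omega
  let n : ℕ → ℕ := fun m => if m % 2 = 0 then E (m / 2) else 2 * E (m / 2) +
    (r (E (m / 2)) (w (m / 2))).1
  let k : ℕ → ℕ := fun m => if m % 2 = 0 then (r (E (m / 2)) (w (m / 2))).1 else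
    (r (E (m / 2)) (w (m / 2))).2 - (2 * E (m / 2) + (r (E (m / 2)) (w (m / 2))).1)
  have n_even : ∀ i, n (2 * i) = E i := fun i => by
    simp only [n]; rw [if_pos (by omega), show 2 * i / 2 = i by omega]
  have n_odd : ∀ i, n (2 * i + 1) = 2 * E i + (r (E i) (w i)).1 := fun i => by
    simp only [n]; rw [if_neg (by omega), show (2 * i + 1) / 2 = i by omega]
  have k_even : ∀ i, k (2 * i) = (r (E i) (w i)).1 := fun i => by
    simp only [k]; rw [if_pos (by omega), show 2 * i / 2 = i by omega]
  have k_odd : ∀ i, k (2 * i + 1) = (r (E i) (w i)).2 - (2 * E i + (r (E i) (w i)).1) :=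
    fun i => by simp only [k]; rw [if_neg (by omega), show (2 * i + 1) / 2 = i by omega]
  refine ⟨n, k, n_even 0, fun j => ?_, fun i => ?_, fun i => ?_⟩
  · obtain ⟨i, rfl | rfl⟩ := Nat.even_or_odd' j
    · rw [n_odd, n_even, k_even]
    · have := hr (E i) (w i) (hE0 i)
      rw [show 2 * i + 1 + 1 = 2 * (i + 1) by ring, n_even, n_odd, k_odd, hE]
      omega
  · have := hr (E i) (w i) (hE0 i)
    rw [k_odd]
    omega
  · obtain ⟨h1, h2, h3⟩ := hr (E i) (w i) (hE0 i)
    have hN : n (2 * i + 1) + k (2 * i + 1) = (r (E i) (w i)).2 := by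
      rw [n_odd, k_odd]; omega
    rw [hN, n_even, k_even]
    exact h3

/-- The integer part of `-log_Q (x ^ 2 * ψ x)`, up to rounding. -/
lemma exists_log_scale {Q : ℝ} (hQ : 1 < Q) {ψ : ℕ → ℝ} (hpos : ∀ n, 0 < ψ n)
    (hdec : ∀ m n : ℕ, m ≤ n → (Q ^ n) ^ 2 * ψ n ≤ (Q ^ m) ^ 2 * ψ m)
    (hlim : Filter.Tendsto (fun n : ℕ => (Q ^ n) ^ 2 * ψ n) Filter.atTop (nhds 0)) :
    ∃ κ : ℕ → ℕ, Monotone κ ∧ (∀ B, ∃ d₀, ∀ d, d₀ ≤ d → B ≤ κ d) ∧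
      (∀ d : ℕ, Q ^ (-(2 * d + κ d : ℤ)) < ψ d) ∧
      ∀ d : ℕ, κ d ≠ 0 → ψ d ≤ Q ^ (-(2 * d + κ d : ℤ)) * Q := by
  have hQ0 : 0 < Q := zero_lt_one.trans hQ
  have hu : ∀ d : ℕ, 0 < (Q ^ d) ^ 2 * ψ d := fun d => mul_pos (by positivity) (hpos d)
  have hex : ∀ d : ℕ, ∃ k : ℕ, 1 < Q ^ k * ((Q ^ d) ^ 2 * ψ d) := fun d => by
    obtain ⟨k, hk⟩ := pow_unbounded_of_one_lt (1 / ((Q ^ d) ^ 2 * ψ d)) hQ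
    exact ⟨k, (div_lt_iff₀ (hu d)).mp hk⟩
  have hz : ∀ d k : ℕ, Q ^ (-(2 * d + k : ℤ)) = (Q ^ k * (Q ^ d) ^ 2)⁻¹ := fun d k => by
    rw [zpow_neg, zpow_add₀ hQ0.ne', zpow_natCast, mul_comm (2 : ℤ), zpow_mul, zpow_natCast,
      mul_comm]
    norm_cast
  refine ⟨fun d => Nat.find (hex d), fun m n hmn => ?_, fun B => ?_, fun d => ?_, fun d hd => ?_⟩
  · apply Nat.find_min'
    have := Nat.find_spec (hex n)
    exact this.trans_le (mul_le_mul_of_nonneg_left (hdec m n hmn) (by positivity))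
  · have hB : (0 : ℝ) < (Q ^ B)⁻¹ := by positivity
    obtain ⟨d₀, hd₀⟩ := Filter.eventually_atTop.mp (hlim.eventually_lt_const hB)
    refine ⟨d₀, fun d hd => ?_⟩
    rw [Nat.le_find_iff]
    intro m hm h
    have h1 := hd₀ d hd
    have h2 : Q ^ m * ((Q ^ d) ^ 2 * ψ d) ≤ Q ^ B * (Q ^ B)⁻¹ :=
      mul_le_mul (pow_le_pow_right₀ hQ.le hm.le) h1.le (hu d).le (by positivity)
    rw [mul_inv_cancel₀ (by positivity)] at h2
    linarith
  · have := Nat.find_spec (hex d)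
    rw [hz, inv_lt_iff_one_lt_mul₀ (by positivity)]
    linarith
  · have h1 := Nat.find_min (hex d) (Nat.sub_one_lt hd)
    rw [not_lt] at h1
    obtain ⟨m, hm⟩ := Nat.exists_eq_succ_of_ne_zero hd
    simp only [hm] at h1 ⊢
    rw [hz, ← div_eq_inv_mul, le_div_iff₀ (by positivity), Nat.succ_eq_add_one, pow_succ]
    simp only [Nat.succ_eq_add_one, Nat.add_sub_cancel] at h1
    nlinarith

end GapSelection

section FoldSeriesDigits

open Polynomial

variable {K : Type} [Field K] {α b : K} {n : ℕ → ℕ}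

lemma foldSeries_coeff (m : ℤ) :
    (toL K (C α) * foldSeries K b n).coeff m =
      if 0 < m then α * b + (if m.toNat ∈ Set.range n then α else 0) else 0 := by
  rw [toL_C, HahnSeries.C_mul_eq_smul, HahnSeries.coeff_smul, foldSeries, HahnSeries.coeff_add,
    toL_C, HahnSeries.C_mul_eq_smul, HahnSeries.coeff_smul, tailSeries, setSeries_coeff,
    setSeries_coeff]
  have : n '' Set.Ici 0 = Set.range n := by
    rw [← Set.image_univ]; congr 1; ext; simp
  rw [this]
  by_cases h : 0 < m <;> by_cases h' : m.toNat ∈ Set.range n <;> simp [h, h', mul_add]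

lemma le_orderTop_scale (hα : α ≠ 0) (h g : K[X]) (m : ℤ) (ξ : LF K) :
    (m : WithTop ℤ) ≤ (toL K h * (toL K (C α) * ξ) - toL K (C α * g)).orderTop ↔
      (m : WithTop ℤ) ≤ (toL K h * ξ - toL K g).orderTop := by
  rw [toL_mul, show toL K h * (toL K (C α) * ξ) - toL K (C α) * toL K g =
    toL K (C α) * (toL K h * ξ - toL K g) by ring, le_orderTop_toL_mul K (C_ne_zero.mpr hα),
    natDegree_C, Nat.cast_zero, add_zero]

lemma mem_MDS_foldSeries {A : Set K} (hA : α * b ∈ A) (hA' : α * b + α ∈ A) :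
    toL K (C α) * foldSeries K b n ∈ MDS K A := by
  refine ⟨fun m hm => ?_, fun m hm => ?_⟩
  · rw [foldSeries_coeff, if_neg (by omega)]
  · rw [foldSeries_coeff, if_pos (by omega)]
    split_ifs
    · exact hA'
    · rwa [add_zero]

lemma eq_of_foldSeries_eq (hα : α ≠ 0) {n' : ℕ → ℕ} (hn0 : 0 < n 0) (hmono : StrictMono n)
    (hn0' : 0 < n' 0) (hmono' : StrictMono n')
    (h : toL K (C α) * foldSeries K b n = toL K (C α) * foldSeries K b n') : n = n' := by
  rw [← hmono.range_inj hmono']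
  ext m
  rcases Nat.eq_zero_or_pos m with rfl | hm
  · have aux : ∀ f : ℕ → ℕ, 0 < f 0 → StrictMono f → 0 ∉ Set.range f := by
      rintro f h0 hf ⟨i, hi⟩
      have := hf.monotone (Nat.zero_le i)
      omega
    exact iff_of_false (aux n hn0 hmono) (aux n' hn0' hmono')
  · have h1 := congrArg (fun f : LF K => f.coeff (m : ℤ)) h
    have hm' : (0 : ℤ) < m := by omega
    simp only [foldSeries_coeff, hm', if_true, Int.toNat_natCast] at h1
    by_cases h2 : m ∈ Set.range n <;> by_cases h3 : m ∈ Set.range n' <;>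
      simp [h2, h3, hα] at h1 ⊢

lemma le_orderTop_of_mem_MDS {A : Set K} {ξ : LF K} (hξ : ξ ∈ MDS K A) :
    ((1 : ℤ) : WithTop ℤ) ≤ ξ.orderTop := by
  rw [HahnSeries.le_orderTop_iff_forall]
  intro m hm
  rw [WithTop.coe_lt_coe] at hm
  exact hξ.1 m (by omega)

end FoldSeriesDigits

section KsetCriteria

open Polynomial

lemma finite_natDegree_lt (M : ℕ) : {g : F[X] | g.natDegree < M}.Finite := by
  have : Finite (degreeLT F M) := Finite.of_equiv _ (degreeLTEquiv F M).toEquiv.symm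
  refine (Set.toFinite (degreeLT F M : Set F[X])).subset fun g hg => ?_
  rw [SetLike.mem_coe, mem_degreeLT]
  exact degree_le_natDegree.trans_lt (by exact_mod_cast hg)

variable {F}
variable {b : F}

lemma mem_unitBall_of_mem_MDS {A : Set F} {ξ : LF F} (hξ : ξ ∈ MDS F A) : ξ ∈ unitBall F := by
  change absv F (ξ - 0) < 1
  rw [sub_zero, ← zpow_zero (qc F : ℝ), ← neg_zero, absv_lt_zpow_iff]
  exact lt_of_lt_of_le (by norm_num) (le_orderTop_of_mem_MDS hξ)

/-- Approximations of bounded denominator degree and bounded error are finite in number. -/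
lemma finite_approx_of_natDegree_lt {ξ : LF F} (hξ : ((1 : ℤ) : WithTop ℤ) ≤ ξ.orderTop)
    (B : ℝ) (d₀ : ℕ) :
    {gh : F[X] × F[X] | gh.2 ≠ 0 ∧ gh.2.natDegree < d₀ ∧
      absv F (ξ - toL F gh.1 / toL F gh.2) < B}.Finite := by
  obtain ⟨M, hM⟩ := pow_unbounded_of_one_lt B (one_lt_qc F)
  refine ((finite_natDegree_lt F (M + d₀ + 1)).prod (finite_natDegree_lt F d₀)).subset ?_
  rintro ⟨g, h⟩ ⟨hh, hd, hB⟩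
  refine ⟨?_, hd⟩
  simp only [Set.mem_ofPred_eq] at *
  have h1 : absv F (ξ - toL F g / toL F h) ≤ (qc F : ℝ) ^ (-(-M : ℤ)) := by
    rw [neg_neg, zpow_natCast]; exact (hB.trans hM).le
  rw [absv_le_zpow_iff, le_orderTop_sub_div F hh] at h1
  have h2 : ((-M - h.natDegree : ℤ) : WithTop ℤ) ≤ (toL F h * ξ).orderTop := by
    rw [le_orderTop_toL_mul F hh]
    refine le_trans ?_ hξ
    rw [WithTop.coe_le_coe]; omega
  have h3 := le_orderTop_sub F h2 h1
  rw [sub_sub_cancel] at h3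
  by_cases hg : g = 0
  · simp [hg]
  · rw [orderTop_toL F hg, WithTop.coe_le_coe] at h3
    omega

lemma mem_Kset_of_frequently {ψ : ℕ → ℝ} {κ : ℕ → ℕ} {ξ : LF F} (hξ : ξ ∈ unitBall F)
    (hκψ : ∀ d : ℕ, (qc F : ℝ) ^ (-(2 * d + κ d : ℤ)) < ψ d)
    (h : ∀ M, ∃ h g : F[X], h ≠ 0 ∧ M ≤ h.natDegree ∧
      ((h.natDegree + κ h.natDegree : ℤ) : WithTop ℤ) ≤ (toL F h * ξ - toL F g).orderTop) :
    ξ ∈ Kset F ψ := by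
  refine ⟨hξ, Set.Infinite.of_image (fun gh => gh.2.natDegree)
    (Set.infinite_of_forall_exists_gt fun M => ?_)⟩
  obtain ⟨h, g, hh, hM, ho⟩ := h (M + 1)
  refine ⟨_, ⟨(g, h), ⟨hh, ?_⟩, rfl⟩, hM⟩
  refine lt_of_le_of_lt ?_ (hκψ h.natDegree)
  rw [absv_le_zpow_iff, le_orderTop_sub_div F hh]
  convert ho using 2
  ring

lemma notMem_Kset_of_eventually {ψ : ℕ → ℝ} {c : ℝ} {κ : ℕ → ℕ} {ξ : LF F}
    (hξ : ((1 : ℤ) : WithTop ℤ) ≤ ξ.orderTop) (hpos : ∀ n, 0 < ψ n)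
    (hdec : ∀ m n : ℕ, m ≤ n → ψ n ≤ ψ m) (hc0 : 0 < c) (hc : c < 1 / (qc F : ℝ))
    (hκψ : ∀ d : ℕ, κ d ≠ 0 → ψ d ≤ (qc F : ℝ) ^ (-(2 * d + κ d : ℤ)) * qc F) {d₀ : ℕ}
    (h : ∀ h g : F[X], h ≠ 0 → d₀ ≤ h.natDegree → κ h.natDegree ≠ 0 ∧
      ¬ ((h.natDegree + κ h.natDegree + 1 : ℤ) : WithTop ℤ) ≤
        (toL F h * ξ - toL F g).orderTop) :
    ξ ∉ Kset F (fun n => c * ψ n) := by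
  rintro ⟨-, hinf⟩
  apply hinf
  refine (finite_approx_of_natDegree_lt hξ (c * ψ 0) d₀).subset ?_
  rintro ⟨g, f⟩ ⟨hf, hlt⟩
  simp only at hf hlt
  refine ⟨hf, ?_, hlt.trans_le (mul_le_mul_of_nonneg_left (hdec _ _ (Nat.zero_le _)) hc0.le)⟩
  by_contra hd
  obtain ⟨h0, h1⟩ := h f g hf (not_lt.mp hd)
  apply h1
  have hq := qc_pos F
  have h2 : c * ψ f.natDegree < (qc F : ℝ) ^ (-(2 * f.natDegree + κ f.natDegree : ℤ)) :=
    calc c * ψ f.natDegree < 1 / (qc F : ℝ) * ψ f.natDegree :=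
          mul_lt_mul_of_pos_right hc (hpos _)
      _ ≤ 1 / (qc F : ℝ) * ((qc F : ℝ) ^ (-(2 * f.natDegree + κ f.natDegree : ℤ)) * qc F) :=
          mul_le_mul_of_nonneg_left (hκψ _ h0) (by positivity)
      _ = _ := by field_simp
  have h3 := hlt.trans h2
  rw [absv_lt_zpow_iff] at h3
  have h4 : ((2 * f.natDegree + κ f.natDegree + 1 : ℤ) : WithTop ℤ) ≤
      (ξ - toL F g / toL F f).orderTop := by
    revert h3
    cases (ξ - toL F g / toL F f).orderTop with
    | top => simp
    | coe a => rw [WithTop.coe_lt_coe, WithTop.coe_le_coe]; omega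
  rw [le_orderTop_sub_div F hf] at h4
  convert h4 using 2
  ring

variable (b) in
/-- Either copies of a gap can be shortened, for periods in a suitable residue class, or no
rational relation allows shortening. -/
lemma exists_shortening (p : ℕ) [CharP F p] (hp : 0 < p) : ∃ σ ν : ℕ,
    (σ = 0 ∨ σ = 1 ∧ b * ν + 1 = 0) ∧
      (σ = 1 ∨ σ = 0 ∧ ∀ x y : ℤ, (x : F) + b * y = 0 → (x : F) = 0) := by
  by_cases h : ∃ ν : ℕ, b * ν + 1 = 0
  · obtain ⟨ν, hν⟩ := h
    exact ⟨1, ν, Or.inr ⟨rfl, hν⟩, Or.inl rfl⟩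
  · refine ⟨0, 0, Or.inl rfl, Or.inr ⟨rfl, fun x y hxy => ?_⟩⟩
    by_contra hx
    apply h
    set z : ℤ := y * x ^ (Fintype.card F - 2) with hz
    refine ⟨(z % p).toNat, ?_⟩
    have h1 : (((z % p).toNat : ℕ) : F) = (z : F) := by
      have h2 : (((z % p).toNat : ℕ) : ℤ) = z % p :=
        Int.toNat_of_nonneg (Int.emod_nonneg _ (by omega))
      rw [← Int.cast_natCast, h2, CharP.intCast_eq_intCast F p]
      exact Int.mod_modEq _ _
    have h2 : (x : F) ^ (Fintype.card F - 2) * x = 1 := by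
      rw [← pow_succ, show Fintype.card F - 2 + 1 = Fintype.card F - 1 by
        have := Fintype.one_lt_card (α := F); omega, FiniteField.pow_card_sub_one_eq_one _ hx]
    rw [h1, hz]
    push_cast
    linear_combination (x : F) ^ (Fintype.card F - 2) * hxy - h2

lemma exists_pair_of_two_le_ncard {A : Set F} (hA : 2 ≤ A.ncard) :
    ∃ a ∈ A, ∃ b ∈ A, b ≠ 0 ∧ a ≠ b := by
  obtain ⟨x, hx, y, hy, hxy⟩ := (Set.one_lt_ncard (Set.toFinite A)).mp hA
  by_cases h : x = 0
  · exact ⟨x, hx, y, hy, fun h' => hxy (h.trans h'.symm), hxy⟩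
  · exact ⟨y, hy, x, hx, h, hxy.symm⟩

end KsetCriteria

/-- Let `𝒜 ⊆ 𝔽_q` with `2 ≤ #𝒜 < q`, and let `ψ : {qⁿ} → ℝ₊` be
non-increasing with `x ↦ x² ψ(x)` non-increasing and tending to `0`.  For any
`c ∈ (0, 1/q)` the set `(𝒦(ψ) \ 𝒦(cψ)) ∩ MDS(𝒜)` is uncountable.
(Here `ψ n` stands for `ψ(qⁿ)`.) -/
theorem mds_Kset_diff_uncountable (A : Set F) (hA1 : 2 ≤ A.ncard) (hA2 : A.ncard < qc F)
    (ψ : ℕ → ℝ) (hpos : ∀ n, 0 < ψ n)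
    (hdec : ∀ m n : ℕ, m ≤ n → ψ n ≤ ψ m)
    (hx2dec : ∀ m n : ℕ, m ≤ n → ((qc F : ℝ) ^ n) ^ 2 * ψ n ≤ ((qc F : ℝ) ^ m) ^ 2 * ψ m)
    (hx2lim : Filter.Tendsto (fun n : ℕ => ((qc F : ℝ) ^ n) ^ 2 * ψ n)
      Filter.atTop (nhds 0))
    (c : ℝ) (hc0 : 0 < c) (hc : c < 1 / (qc F : ℝ)) :
    ¬ ((Kset F ψ \ Kset F (fun n => c * ψ n)) ∩ MDS F A).Countable := by
  obtain ⟨a, ha, b, hb, hb0, hab⟩ := exists_pair_of_two_le_ncard hA1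
  obtain ⟨κ, hκ, hκB, hκ1, hκ2⟩ := exists_log_scale (one_lt_qc F) hpos hx2dec hx2lim
  obtain ⟨p, hchar⟩ := CharP.exists F
  have hp : 0 < p := Nat.pos_of_ne_zero (CharP.char_ne_zero_of_finite F p)
  have hα : a - b ≠ 0 := sub_ne_zero.mpr hab
  set α := a - b with hαdef
  have hβ : b / α ≠ 0 := div_ne_zero hb0 hα
  set β := b / α with hβdef
  have hαβ : α * β = b := by rw [hβdef]; field_simp
  obtain ⟨σ, ν, hσν, hσ⟩ := exists_shortening β p hp
  have hσ1 : σ ≤ 1 := by omega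
  obtain ⟨n₀, hn₀⟩ := hκB (2 * σ)
  have hseq := fun W : Set ℕ => exists_fold_sequence hκ hp hσ1 ν (Nat.succ_pos n₀)
    (hn₀ _ (Nat.le_succ n₀)) (fun i => if i ∈ W then 1 else 0)
  choose n k h0 hrec hw hext using hseq
  have hn0 : ∀ W, 0 < n W 0 := fun W => by rw [h0]; exact Nat.succ_pos n₀
  have hmono := fun W => strictMono_of_fold (hn0 W) (hrec W)
  have hinj : Function.Injective fun W => toL F (Polynomial.C α) * foldSeries F β (n W) := by
    intro W W' hWW
    have hn := eq_of_foldSeries_eq hα (hn0 W) (hmono W) (hn0 W') (hmono W') hWW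
    ext i
    have h1 := hw W i
    have h2 := hw W' i
    have h3 := hrec W (2 * i + 1)
    have h4 := hrec W' (2 * i + 1)
    rw [hn] at h3
    have h5 : k W (2 * i + 1) = k W' (2 * i + 1) := by omega
    by_cases hi : i ∈ W <;> by_cases hi' : i ∈ W' <;> simp [hi, hi'] at h1 h2 ⊢ <;> omega
  have hmem : ∀ W, toL F (Polynomial.C α) * foldSeries F β (n W) ∈
      (Kset F ψ \ Kset F (fun n => c * ψ n)) ∩ MDS F A := by
    intro W
    have hM : toL F (Polynomial.C α) * foldSeries F β (n W) ∈ MDS F A :=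
      mem_MDS_foldSeries (by rwa [hαβ]) (by rwa [hαβ, hαdef, add_sub_cancel])
    have hgap : ∀ i, k W i ≤ 2 * p ∨ k W i ≤ κ (n W i + 1) + 2 ∧
        k W i + 2 * σ ≤ κ (n W i + (n W (i + 1) + k W (i + 1)) - σ) := by
      intro j
      obtain ⟨i, rfl | rfl⟩ := Nat.even_or_odd' j
      · exact Or.inr ⟨(hext W i).2.1, (hext W i).2.2.1⟩
      · left
        have := (hw W i).2
        split_ifs at this <;> omega
    obtain ⟨d₀, hd₀⟩ := hκB (n₀ + 1 + 2 * p + 2)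
    refine ⟨⟨mem_Kset_of_frequently (mem_unitBall_of_mem_MDS hM) hκ1 fun M => ?_,
      notMem_Kset_of_eventually (le_orderTop_of_mem_MDS hM) hpos hdec hc0 hc hκ2 (d₀ := d₀)
        fun h g hh hd => ?_⟩, hM⟩
    · have happ : ∃ h g : Polynomial F, h ≠ 0 ∧ n W (2 * M) ≤ h.natDegree ∧
          ((h.natDegree + κ h.natDegree : ℤ) : WithTop ℤ) ≤
            (toL F h * foldSeries F β (n W) - toL F g).orderTop := by
        obtain ⟨hN, -, -, hk | hk⟩ := hext W M
        · exact exists_approx_of_gap (hn0 W) (hrec W) hk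
        · refine exists_approx_of_copy (hn0 W) (hrec W) (hσν.imp_right fun h => ⟨h.1, ?_⟩) hk
          rw [(CharP.natCast_eq_natCast F p).mpr hN]
          exact h.2
      obtain ⟨h, g, hh, hd, ho⟩ := happ
      have hM' : 2 * M ≤ n W (2 * M) := (hmono W).le_apply
      exact ⟨h, Polynomial.C α * g, hh, by omega,
        (le_orderTop_scale hα h g _ _).mpr ho⟩
    · have hlarge := hd₀ _ hd
      refine ⟨by omega, fun ho => ?_⟩
      have hg : g = Polynomial.C α * (Polynomial.C α⁻¹ * g) := by
        rw [← mul_assoc, ← Polynomial.C_mul, mul_inv_cancel₀ hα, Polynomial.C_1, one_mul]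
      rw [hg, le_orderTop_scale hα] at ho
      exact not_le_orderTop_foldSeries (hn0 W) (hrec W) hβ hκ hσ hgap _ hh
        (by rw [h0]; omega) ho
  intro hcount
  have := hcount.to_subtype
  obtain ⟨f, hf⟩ := exists_injective_nat
    ((Kset F ψ \ Kset F (fun n => c * ψ n)) ∩ MDS F A : Set (LF F))
  exact Function.cantor_injective (fun W => f ⟨_, hmem W⟩) fun W W' h =>
    hinj (congrArg Subtype.val (hf h))
end
end
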